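/- arXiv:2510.03600 — 2 statements merged into one kernel-verified Lean document; each statement's English description precedes it below -/
import Mathlib

section
/- Let H be a complex Hilbert space with an orthonormal basis (φ_n), let (λ_n) be positive reals, let 0 < α ≤ 1/2, and let u₀ ∈ H. If Σ_n ⟨u₀, φ_n⟩ E_{α,1}(-i λ_n T^α) φ_n = 0 for some T > 0, then u₀ = 0. -/
open Complex Real

/-- The Mittag-Leffler function `E_{α,β}(z) = ∑ zⁿ / Γ(αn+β)`. -/
noncomputable def mlE (α β : ℝ) (z : ℂ) : ℂ :=
  ∑' n : ℕ, z ^ n / Complex.Gamma ((α * n + β : ℝ) : ℂ)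

open Filter Topology

noncomputable def mlG (a : ℝ) (k : ℕ) : ℝ := ∏ j ∈ Finset.range k, (a + j) / (j + 1)

noncomputable def mlF (a : ℝ) : PowerSeries ℝ := PowerSeries.mk (mlG a)

theorem mlG_succ (a : ℝ) (k : ℕ) : mlG a (k + 1) * (k + 1) = (a + k) * mlG a k := by
  unfold mlG
  rw [Finset.prod_range_succ]
  have : (k : ℝ) + 1 ≠ 0 := by positivity
  field_simp

theorem mlF_ode (a : ℝ) :
    PowerSeries.derivative ℝ (mlF a) * (1 - PowerSeries.X) = PowerSeries.C a * mlF a := by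
  ext k
  rw [mul_sub, mul_one, map_sub, PowerSeries.coeff_derivative, PowerSeries.coeff_C_mul]
  cases k with
  | zero =>
    have := mlG_succ a 0
    simp [mlF] at *
    linarith
  | succ k =>
    rw [PowerSeries.coeff_succ_mul_X, PowerSeries.coeff_derivative]
    have h := mlG_succ a (k + 1)
    simp only [mlF, PowerSeries.coeff_mk]
    push_cast at *
    linarith

theorem mlF_unique (a : ℝ) (P : PowerSeries ℝ) (h0 : PowerSeries.coeff 0 P = 1)
    (h : PowerSeries.derivative ℝ P * (1 - PowerSeries.X) = PowerSeries.C a * P) : P = mlF a := by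
  ext k
  induction k with
  | zero => rw [h0]; simp [mlF, mlG]
  | succ k ih =>
    have h2 : (PowerSeries.coeff (k + 1) P) * (k + 1) = (a + k) * PowerSeries.coeff k P := by
      have h1 := congrArg (PowerSeries.coeff k) h
      rw [mul_sub, mul_one, map_sub, PowerSeries.coeff_derivative, PowerSeries.coeff_C_mul] at h1
      cases k with
      | zero => simp at *; linarith
      | succ k =>
        rw [PowerSeries.coeff_succ_mul_X, PowerSeries.coeff_derivative] at h1
        push_cast at *
        linarith
    have h3 := mlG_succ a k
    have : (k : ℝ) + 1 ≠ 0 := by positivity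
    apply mul_right_cancel₀ this
    rw [h2, ih]
    simp only [mlF, PowerSeries.coeff_mk]
    linarith

theorem mlF_mul (a b : ℝ) : mlF a * mlF b = mlF (a + b) := by
  apply mlF_unique
  · simp [mlF, mlG]
  · rw [Derivation.leibniz, map_add]
    simp only [smul_eq_mul]
    linear_combination mlF b * mlF_ode a + mlF a * mlF_ode b

theorem mlF_zero : mlF 0 = 1 := by
  symm
  apply mlF_unique
  · simp
  · simp

theorem mlF_pow (a : ℝ) (n : ℕ) : mlF a ^ n = mlF (n * a) := by
  induction n with
  | zero => simp [mlF_zero]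
  | succ n ih => rw [pow_succ, ih, mlF_mul]; congr 1; push_cast; ring

theorem geom_aux {R : Type*} [CommRing R] (f : R) (k n : ℕ) :
    f ^ (k + 1) ∣ 1 - (1 - f) ^ (n + 1) * ∑ j ∈ Finset.range (k + 1), ((j + n).choose n : R) * f ^ j := by
  have hrec : ∀ n k : ℕ, (1 - f) * ∑ j ∈ Finset.range (k + 1), ((j + (n + 1)).choose (n + 1) : R) * f ^ j
      = (∑ j ∈ Finset.range (k + 1), ((j + n).choose n : R) * f ^ j)
        - ((k + (n + 1)).choose (n + 1) : R) * f ^ (k + 1) := by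
    intro n k
    induction k with
    | zero => simp
    | succ k ih =>
      rw [Finset.sum_range_succ, mul_add, ih, Finset.sum_range_succ _ (k + 1)]
      have : ((k + 1 + (n + 1)).choose (n + 1) : R)
          = ((k + 1 + n).choose n : R) + ((k + (n + 1)).choose (n + 1) : R) := by
        rw [← Nat.cast_add]
        congr 1
        rw [← add_assoc, Nat.choose_succ_succ]
        congr 2; ring
      rw [this]; ring
  induction n with
  | zero =>
    have : (1 - f) * ∑ j ∈ Finset.range (k + 1), f ^ j = 1 - f ^ (k + 1) := by
      rw [mul_neg_geom_sum]
    simp [this]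
  | succ n ih =>
    rw [pow_succ _ (n + 1), mul_assoc, hrec, mul_sub]
    have : 1 - ((1 - f) ^ (n + 1) * ∑ j ∈ Finset.range (k + 1), ((j + n).choose n : R) * f ^ j -
        (1 - f) ^ (n + 1) * (((k + (n + 1)).choose (n + 1) : R) * f ^ (k + 1)))
        = (1 - (1 - f) ^ (n + 1) * ∑ j ∈ Finset.range (k + 1), ((j + n).choose n : R) * f ^ j)
          + f ^ (k + 1) * ((1 - f) ^ (n + 1) * ((k + (n + 1)).choose (n + 1) : R)) := by ring
    rw [this]
    exact dvd_add ih (dvd_mul_right _ _)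

/-- the weights -/
noncomputable def mlp (α : ℝ) (k j : ℕ) : ℝ :=
  PowerSeries.coeff k ((1 - mlF (-α)) ^ j * mlF (1 - α))

theorem mlp_moment (α : ℝ) (k n : ℕ) :
    ∑ j ∈ Finset.range (k + 1), ((j + n).choose n : ℝ) * mlp α k j = mlG (1 + α * n) k := by
  obtain ⟨q, hq⟩ := geom_aux (1 - mlF (-α)) k n
  have hX : (PowerSeries.X : PowerSeries ℝ) ∣ 1 - mlF (-α) := by
    rw [PowerSeries.X_dvd_iff]
    rw [← PowerSeries.coeff_zero_eq_constantCoeff_apply]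
    simp only [map_sub, mlF, PowerSeries.coeff_mk]
    simp [mlG]
  have hXk := pow_dvd_pow_of_dvd hX (k + 1)
  rw [sub_sub_cancel, mlF_pow] at hq
  have h1 : mlF (1 - α) = mlF (1 + α * n) * mlF (((n + 1 : ℕ) : ℝ) * -α) := by
    rw [mlF_mul]; congr 1; push_cast; ring
  have h2 : ∑ j ∈ Finset.range (k + 1), ((j + n).choose n : ℝ) * mlp α k j
      = PowerSeries.coeff k (mlF (1 - α) * ∑ j ∈ Finset.range (k + 1),
        ((j + n).choose n : PowerSeries ℝ) * (1 - mlF (-α)) ^ j) := by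
    rw [Finset.mul_sum, map_sum]
    apply Finset.sum_congr rfl
    intro j _
    rw [mlp, ← PowerSeries.coeff_C_mul]
    congr 1
    rw [map_natCast]
    ring
  have h3 : mlF (1 - α) * ∑ j ∈ Finset.range (k + 1),
        ((j + n).choose n : PowerSeries ℝ) * (1 - mlF (-α)) ^ j
      = mlF (1 + α * n) - (1 - mlF (-α)) ^ (k + 1) * q * mlF (1 + α * n) := by
    rw [h1]
    linear_combination (-mlF (1 + α * n)) * hq
  rw [h2, h3, map_sub]
  have h4 : PowerSeries.coeff k ((1 - mlF (-α)) ^ (k + 1) * q * mlF (1 + α * n)) = 0 := by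
    apply PowerSeries.X_pow_dvd_iff.mp _ k (Nat.lt_succ_self k)
    exact (hXk.mul_right _).mul_right _
  rw [h4, sub_zero]
  simp [mlF]

theorem coeff_mul_nonneg {P Q : PowerSeries ℝ} (hP : ∀ k, 0 ≤ PowerSeries.coeff k P)
    (hQ : ∀ k, 0 ≤ PowerSeries.coeff k Q) (k : ℕ) : 0 ≤ PowerSeries.coeff k (P * Q) := by
  rw [PowerSeries.coeff_mul]
  exact Finset.sum_nonneg fun x _ => mul_nonneg (hP _) (hQ _)

theorem mlG_nonneg {a : ℝ} (ha : 0 ≤ a) (k : ℕ) : 0 ≤ mlG a k :=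
  Finset.prod_nonneg fun j _ => by positivity

theorem mlp_nonneg {α : ℝ} (h0 : 0 < α) (h1 : α ≤ 1) (k j : ℕ) : 0 ≤ mlp α k j := by
  unfold mlp
  have hf : ∀ k, 0 ≤ PowerSeries.coeff k (1 - mlF (-α)) := by
    intro k
    cases k with
    | zero => simp [mlF, mlG]
    | succ k =>
      simp only [map_sub, mlF, PowerSeries.coeff_mk, PowerSeries.coeff_one]
      simp only [Nat.add_eq_zero_iff, one_ne_zero, and_false, if_false, zero_sub]
      rw [mlG, Finset.prod_range_succ', neg_nonneg]
      apply mul_nonpos_of_nonneg_of_nonpos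
      · apply Finset.prod_nonneg
        intro j _
        apply div_nonneg _ (by positivity)
        push_cast
        have : (0 : ℝ) ≤ j := by positivity
        linarith
      · simp; linarith
  apply coeff_mul_nonneg
  · induction j with
    | zero =>
      intro k
      rw [pow_zero, PowerSeries.coeff_one]
      split_ifs <;> norm_num
    | succ j ih => rw [pow_succ]; exact coeff_mul_nonneg ih hf
  · intro k
    simp only [mlF, PowerSeries.coeff_mk]
    exact mlG_nonneg (by linarith) k

theorem mlG_tendsto {s : ℝ} (hs : 0 ≤ s) :
    Tendsto (fun k : ℕ => mlG (1 + s) k * (k : ℝ) ^ (-s)) atTop (𝓝 (Real.Gamma (s + 1))⁻¹) := by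
  have hg := Real.GammaSeq_tendsto_Gamma (s + 1)
  have hG : Real.Gamma (s + 1) ≠ 0 := (Real.Gamma_pos_of_pos (by linarith)).ne'
  have h1 : Tendsto (fun k : ℕ => (k : ℝ) / (k + (s + 1))) atTop (𝓝 1) :=
    tendsto_natCast_div_add_atTop (s + 1)
  have h2 := h1.mul (hg.inv₀ hG)
  rw [one_mul] at h2
  refine h2.congr' ?_
  filter_upwards [eventually_gt_atTop 0] with k hk
  have hk' : (0 : ℝ) < k := by exact_mod_cast hk
  have hf : mlG (1 + s) k = (∏ j ∈ Finset.range k, (s + 1 + j)) / (k.factorial : ℝ) := by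
    rw [mlG, Finset.prod_div_distrib, ← Finset.prod_range_add_one_eq_factorial]
    push_cast
    congr 1
    exact Finset.prod_congr rfl fun j _ => by ring
  rw [Real.GammaSeq, hf, Finset.prod_range_succ, Real.rpow_neg hk'.le, Real.rpow_add_one hk'.ne']
  have h3 : ∏ j ∈ Finset.range k, (s + 1 + (j : ℝ)) ≠ 0 :=
    Finset.prod_ne_zero_iff.mpr fun j _ => by positivity
  have h4 : (k : ℝ) ^ s ≠ 0 := (Real.rpow_pos_of_pos hk' s).ne'
  have h5 : (k.factorial : ℝ) ≠ 0 := by positivity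
  have h6 : s + 1 + (k : ℝ) ≠ 0 := by positivity
  have h7 : (k : ℝ) + (s + 1) ≠ 0 := by positivity
  field_simp
  ring

theorem mlG_anti {s : ℝ} (hs : 0 ≤ s) {K k : ℕ} (hK : 1 ≤ K) (hk : K ≤ k) :
    mlG (1 + s) k * (k : ℝ) ^ (-s) ≤ mlG (1 + s) K * (K : ℝ) ^ (-s) := by
  induction k, hk using Nat.le_induction with
  | base => exact le_rfl
  | succ k hk ih =>
    refine le_trans ?_ ih
    have hk' : (0 : ℝ) < k := by exact_mod_cast (by omega : 0 < k)
    have h1 := mlG_succ (1 + s) k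
    have hb : 1 + s / (k + 1) ≤ (((k : ℝ) + 1) / k) ^ s := by
      have e1 : Real.exp (1 / (k + 1)) ≤ ((k : ℝ) + 1) / k := by
        have := Real.add_one_le_exp (-(1 / ((k : ℝ) + 1)))
        have h2 : -(1 / ((k : ℝ) + 1)) + 1 = k / (k + 1) := by field_simp; ring
        rw [h2, Real.exp_neg, le_inv_comm₀ (by positivity) (by positivity), inv_div] at this
        exact this
      calc 1 + s / (k + 1) ≤ Real.exp (s / (k + 1)) := by
            linarith [Real.add_one_le_exp (s / ((k : ℝ) + 1))]
        _ = (Real.exp (1 / (k + 1))) ^ s := by rw [← Real.exp_mul]; congr 1; ring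
        _ ≤ _ := Real.rpow_le_rpow (by positivity) e1 hs
    have h3 : mlG (1 + s) (k + 1) = (1 + s / (k + 1)) * mlG (1 + s) k := by
      have : (k : ℝ) + 1 ≠ 0 := by positivity
      apply mul_right_cancel₀ this
      rw [h1]; field_simp; ring
    rw [h3]
    have hg := mlG_nonneg (a := 1 + s) (by linarith) k
    rw [Real.div_rpow (by positivity) hk'.le, le_div_iff₀ (by positivity)] at hb
    push_cast
    rw [Real.rpow_neg (by positivity), Real.rpow_neg hk'.le, mul_comm _ (mlG _ _), mul_assoc]
    apply mul_le_mul_of_nonneg_left _ hg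
    rw [← div_eq_mul_inv, div_le_iff₀ (by positivity), inv_mul_eq_div, le_div_iff₀ (by positivity)]
    exact hb

theorem ml_hasSum (α : ℝ) (k : ℕ) {y : ℂ} (hy : ‖y‖ < 1) :
    HasSum (fun n : ℕ => y ^ n * (mlG (1 + α * n) k : ℂ))
      (∑ j ∈ Finset.range (k + 1), (mlp α k j : ℂ) * (1 / (1 - y) ^ (j + 1))) := by
  have h := hasSum_sum (s := Finset.range (k + 1)) fun j _ =>
    (hasSum_choose_mul_geometric_of_norm_lt_one j hy).mul_left (mlp α k j : ℂ)
  refine h.congr_fun ?_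
  intro n
  rw [← mlp_moment α k n]
  push_cast
  rw [Finset.mul_sum]
  refine Finset.sum_congr rfl fun j _ => ?_
  rw [show (j + n).choose n = (n + j).choose j by
    rw [add_comm, Nat.choose_symm_add]]
  ring

theorem ml_term (α : ℝ) (k n : ℕ) (z : ℂ) :
    (z * ((k : ℝ) ^ (-α) : ℝ)) ^ n * (mlG (1 + α * n) k : ℂ)
      = z ^ n * ((mlG (1 + α * n) k * (k : ℝ) ^ (-(α * n)) : ℝ) : ℂ) := by
  rw [← neg_mul, Real.rpow_mul_natCast (by positivity)]
  push_cast
  ring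

theorem ml_small (α : ℝ) (h0 : 0 < α) (z : ℂ) :
    Tendsto (fun k : ℕ => z * (((k : ℝ) ^ (-α) : ℝ) : ℂ)) atTop (𝓝 0) := by
  have h := (tendsto_rpow_neg_atTop h0).comp (tendsto_natCast_atTop_atTop (R := ℝ))
  have h2 := (Complex.continuous_ofReal.tendsto 0).comp h
  simpa [Function.comp_def] using h2.const_mul z

theorem ml_main (α : ℝ) (h0 : 0 < α) (z : ℂ) :
    Summable (fun n : ℕ => z ^ n / Complex.Gamma ((α * n + 1 : ℝ) : ℂ)) ∧
    Tendsto (fun k : ℕ => ∑ j ∈ Finset.range (k + 1),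
      (mlp α k j : ℂ) * (1 / (1 - z * (((k : ℝ) ^ (-α) : ℝ) : ℂ)) ^ (j + 1)))
      atTop (𝓝 (mlE α 1 z)) := by
  have hev : ∀ᶠ k : ℕ in atTop, ‖z * (((k : ℝ) ^ (-α) : ℝ) : ℂ)‖ < 1 := by
    have := (ml_small α h0 z).norm
    rw [norm_zero] at this
    exact this.eventually_lt_const one_pos
  obtain ⟨K, hK, hK1⟩ := (hev.and (eventually_ge_atTop 1)).exists
  have hsum := (ml_hasSum α K hK).summable.norm
  have hnn : ∀ n : ℕ, 0 ≤ α * n := fun n => by positivity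
  have hab : ∀ n : ℕ, Tendsto (fun k : ℕ =>
      (z * ((k : ℝ) ^ (-α) : ℝ)) ^ n * (mlG (1 + α * n) k : ℂ)) atTop
      (𝓝 (z ^ n / Complex.Gamma ((α * n + 1 : ℝ) : ℂ))) := by
    intro n
    simp_rw [ml_term]
    rw [div_eq_mul_inv, Complex.Gamma_ofReal, ← Complex.ofReal_inv]
    exact ((Complex.continuous_ofReal.tendsto _).comp (mlG_tendsto (hnn n))).const_mul _
  have hbd : ∀ᶠ k : ℕ in atTop, ∀ n : ℕ,
      ‖(z * ((k : ℝ) ^ (-α) : ℝ)) ^ n * (mlG (1 + α * n) k : ℂ)‖ ≤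
      ‖(z * ((K : ℝ) ^ (-α) : ℝ)) ^ n * (mlG (1 + α * n) K : ℂ)‖ := by
    filter_upwards [eventually_ge_atTop K] with k hk n
    rw [ml_term, ml_term, norm_mul, norm_mul, Complex.norm_real, Complex.norm_real]
    apply mul_le_mul_of_nonneg_left _ (norm_nonneg _)
    have hp : ∀ k : ℕ, 0 ≤ mlG (1 + α * n) k * (k : ℝ) ^ (-(α * n)) := fun k =>
      mul_nonneg (mlG_nonneg (by linarith [hnn n]) k) (by positivity)
    rw [Real.norm_of_nonneg (hp k), Real.norm_of_nonneg (hp K)]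
    exact mlG_anti (hnn n) hK1 hk
  constructor
  · refine Summable.of_norm_bounded hsum fun n => ?_
    refine le_of_tendsto (hab n).norm ?_
    filter_upwards [hbd] with k hk
    exact hk n
  · refine (tendsto_tsum_of_dominated_convergence hsum hab hbd).congr' ?_
    filter_upwards [hev] with k hk
    exact (ml_hasSum α k hk).tsum_eq

theorem mlp_sum (α : ℝ) (k : ℕ) : ∑ j ∈ Finset.range (k + 1), mlp α k j = 1 := by
  have h := mlp_moment α k 0
  simp only [Nat.choose_zero_right, Nat.cast_one, one_mul, Nat.cast_zero, mul_zero, add_zero] at h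
  rw [h, mlG]
  refine Finset.prod_eq_one fun j _ => ?_
  have : (j : ℝ) + 1 ≠ 0 := by positivity
  field_simp
  ring

theorem mlE_norm_le {α : ℝ} (h0 : 0 < α) (h1 : α ≤ 1) {z : ℂ} (hz : z.re ≤ 0) :
    ‖mlE α 1 z‖ ≤ 1 := by
  refine le_of_tendsto (ml_main α h0 z).2.norm (Eventually.of_forall fun k => ?_)
  rw [← mlp_sum α k]
  refine (norm_sum_le _ _).trans (Finset.sum_le_sum fun j _ => ?_)
  rw [norm_mul, Complex.norm_real, Real.norm_of_nonneg (mlp_nonneg h0 h1 k j)]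
  apply mul_le_of_le_one_right (mlp_nonneg h0 h1 k j)
  rw [norm_div, norm_one, norm_pow]
  have : 1 ≤ ‖1 - z * (((k : ℝ) ^ (-α) : ℝ) : ℂ)‖ := by
    refine le_trans ?_ (Complex.re_le_norm _)
    rw [Complex.sub_re, Complex.re_mul_ofReal, Complex.one_re]
    have : 0 ≤ (k : ℝ) ^ (-α) := by positivity
    nlinarith
  exact div_le_one_of_le₀ (one_le_pow₀ this) (by positivity)

theorem mlE_re_pos {β : ℝ} (h0 : 0 < β) (h1 : β ≤ 1) {x : ℝ} (hx : 0 ≤ x) :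
    0 < (mlE β 1 (-(x : ℂ))).re := by
  have ht := (Complex.continuous_re.tendsto _).comp (ml_main β h0 (-(x : ℂ))).2
  have hm := ((mlG_tendsto h0.le).const_mul (-x)).rexp
  refine lt_of_lt_of_le (Real.exp_pos _) (le_of_tendsto_of_tendsto' hm ht fun k => ?_)
  set y : ℝ := x * (k : ℝ) ^ (-β) with hy
  have hy0 : 0 ≤ y := by positivity
  have hre : (∑ j ∈ Finset.range (k + 1),
      (mlp β k j : ℂ) * (1 / (1 - -(x : ℂ) * (((k : ℝ) ^ (-β) : ℝ) : ℂ)) ^ (j + 1)))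
      = ((∑ j ∈ Finset.range (k + 1), mlp β k j * (1 / (1 + y) ^ (j + 1)) : ℝ) : ℂ) := by
    push_cast [hy]
    simp only [neg_mul, sub_neg_eq_add]
  simp only [Function.comp_apply]
  rw [hre, Complex.ofReal_re]
  have hmom := mlp_moment β k 1
  simp only [Nat.choose_one_right, Nat.cast_one, mul_one] at hmom
  set m : ℝ := y * mlG (1 + β) k with hmdef
  have e1 : -x * (mlG (1 + β) k * (k : ℝ) ^ (-β)) = -m := by rw [hmdef, hy]; ring
  rw [e1]
  calc Real.exp (-m) = ∑ j ∈ Finset.range (k + 1),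
        mlp β k j * (Real.exp (-m) * (1 - y * ((j + 1 : ℕ) : ℝ) + m)) := by
        have : ∀ j ∈ Finset.range (k + 1),
            mlp β k j * (Real.exp (-m) * (1 - y * ((j + 1 : ℕ) : ℝ) + m))
            = Real.exp (-m) * ((1 + m) * mlp β k j - y * (((j + 1 : ℕ) : ℝ) * mlp β k j)) :=
          fun j _ => by ring
        rw [Finset.sum_congr rfl this, ← Finset.mul_sum, Finset.sum_sub_distrib, ← Finset.mul_sum,
          ← Finset.mul_sum, hmom, mlp_sum]
        rw [← hmdef]; ring
    _ ≤ _ := by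
        refine Finset.sum_le_sum fun j _ => mul_le_mul_of_nonneg_left ?_ (mlp_nonneg h0 h1 k j)
        calc Real.exp (-m) * (1 - y * ((j + 1 : ℕ) : ℝ) + m)
            ≤ Real.exp (-m) * Real.exp (m - y * ((j + 1 : ℕ) : ℝ)) := by
              apply mul_le_mul_of_nonneg_left _ (Real.exp_pos _).le
              linarith [Real.add_one_le_exp (m - y * ((j + 1 : ℕ) : ℝ))]
          _ = (Real.exp (((j + 1 : ℕ) : ℝ) * y))⁻¹ := by
              rw [← Real.exp_add, ← Real.exp_neg]; congr 1; ring
          _ ≤ 1 / (1 + y) ^ (j + 1) := by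
              rw [one_div, Real.exp_nat_mul]
              apply inv_anti₀ (by positivity)
              apply pow_le_pow_left₀ (by positivity)
              linarith [Real.add_one_le_exp y]

theorem re_even_odd (g : ℕ → ℂ) (hs : Summable g) (h1 : ∀ n, (g (2 * n + 1)).re = 0) :
    (∑' n, g n).re = (∑' n, g (2 * n)).re := by
  have he : Summable fun n : ℕ => g (2 * n) :=
    hs.comp_injective (i := fun n : ℕ => 2 * n) fun a b h => by simpa using h
  have ho : Summable fun n : ℕ => g (2 * n + 1) :=
    hs.comp_injective (i := fun n : ℕ => 2 * n + 1) fun a b h => by simpa using h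
  rw [← tsum_even_add_odd he ho, Complex.add_re, Complex.re_tsum ho]
  simp [h1]

theorem mlE_imag_re {α : ℝ} (h0 : 0 < α) (t : ℝ) :
    (mlE α 1 (Complex.I * t)).re = (mlE (2 * α) 1 (-((t ^ 2 : ℝ) : ℂ))).re := by
  have hs := (ml_main α h0 (Complex.I * t)).1
  have h1 : ∀ n : ℕ, ((Complex.I * t) ^ (2 * n + 1) /
      Complex.Gamma ((α * (2 * n + 1 : ℕ) + 1 : ℝ) : ℂ)).re = 0 := by
    intro n
    rw [Complex.Gamma_ofReal, Complex.div_ofReal_re, pow_succ, pow_mul, mul_pow, Complex.I_sq]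
    have : (-1 * (t : ℂ) ^ 2) ^ n * (Complex.I * t) = (((-1 * t ^ 2) ^ n * t : ℝ) : ℂ) * Complex.I := by
      push_cast; ring
    rw [this, Complex.re_ofReal_mul, Complex.I_re, mul_zero, zero_div]
  have h2 : ∀ n : ℕ, (Complex.I * (t : ℂ)) ^ (2 * n) /
      Complex.Gamma ((α * (2 * n : ℕ) + 1 : ℝ) : ℂ)
      = (-((t ^ 2 : ℝ) : ℂ)) ^ n / Complex.Gamma ((2 * α * n + 1 : ℝ) : ℂ) := by
    intro n
    have e1 : (α * (2 * n : ℕ) + 1 : ℝ) = 2 * α * n + 1 := by push_cast; ring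
    have e2 : (Complex.I * (t : ℂ)) ^ 2 = -((t ^ 2 : ℝ) : ℂ) := by
      rw [mul_pow, Complex.I_sq]; push_cast; ring
    rw [pow_mul, e1, e2]
  unfold mlE
  rw [re_even_odd _ hs h1]
  exact congrArg Complex.re (tsum_congr h2)

theorem basis_aux {H : Type*} [NormedAddCommGroup H] [InnerProductSpace ℂ H]
    [CompleteSpace H] (b : HilbertBasis ℕ ℂ H) (u₀ : H) (e : ℕ → ℂ) (hb : ∀ n, ‖e n‖ ≤ 1)
    (hne : ∀ n, e n ≠ 0) (hfinal : (∑' n : ℕ, (b.repr u₀ n * e n) • b n) = 0) : u₀ = 0 := by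
  have hc : Memℓp (fun n => b.repr u₀ n * e n) 2 := by
    refine (lp.memℓp (b.repr u₀)).mono' ?_
    intro n
    rw [norm_mul]
    exact mul_le_of_le_one_right (norm_nonneg _) (hb n)
  have hs := (b.hasSum_repr_symm ⟨_, hc⟩).tsum_eq
  have h0 : b.repr.symm ⟨_, hc⟩ = 0 := hs.symm.trans hfinal
  have h1 : (⟨_, hc⟩ : lp (fun _ : ℕ => ℂ) 2) = 0 :=
    (LinearIsometryEquiv.map_eq_zero_iff b.repr.symm).mp h0
  have h2 : b.repr u₀ = 0 := by
    ext n
    have h3 : b.repr u₀ n * e n = 0 := congrFun (congrArg Subtype.val h1) n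
    exact (mul_eq_zero.mp h3).resolve_right (hne n)
  exact (LinearIsometryEquiv.map_eq_zero_iff b.repr).mp h2

theorem backward_uniqueness (H : Type*) [NormedAddCommGroup H] [InnerProductSpace ℂ H]
    [CompleteSpace H] (b : HilbertBasis ℕ ℂ H)
    (lam : ℕ → ℝ) (hlam : ∀ n, 0 < lam n)
    (α : ℝ) (hα0 : 0 < α) (hα : α ≤ 1 / 2)
    (T : ℝ) (hT : 0 < T) (u₀ : H)
    (hfinal : (∑' n : ℕ, (b.repr u₀ n * mlE α 1 (-Complex.I * lam n * (T ^ α : ℝ))) • b n)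
      = 0) :
    u₀ = 0 := by
  have hz : ∀ n, -Complex.I * lam n * (T ^ α : ℝ)
      = Complex.I * ((-(lam n * T ^ α) : ℝ) : ℂ) := by
    intro n; push_cast; ring
  have hb : ∀ n, ‖mlE α 1 (-Complex.I * lam n * (T ^ α : ℝ))‖ ≤ 1 := by
    intro n
    apply mlE_norm_le hα0 (by linarith)
    rw [hz, Complex.re_mul_ofReal]
    simp
  have hne : ∀ n, mlE α 1 (-Complex.I * lam n * (T ^ α : ℝ)) ≠ 0 := by
    intro n h
    have h1 := mlE_re_pos (β := 2 * α) (by linarith) (by linarith)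
      (sq_nonneg (-(lam n * T ^ α)))
    rw [← mlE_imag_re hα0, ← hz, h] at h1
    simp at h1
  exact basis_aux b u₀ _ hb hne hfinal
end

section
/- Let 0 < α < 1 and λ, t > 0. Then there is a constant C depending only on α such that λ^{1/2} |E_{α,1}(-i λ t^α)| ≤ C t^{-α/2} (i.e., |E_{α,1}(-i λ t^α)|² λ ≤ C² t^{-α}). Consequently, for u₀ ∈ H the solution u(t) = Σ_n ⟨u₀,φ_n⟩ E_{α,1}(-i λ_n t^α) φ_n satisfies ‖u(t)‖_{1/2}² ≤ C² t^{-α} ‖u₀‖² for t > 0. -/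
open Complex Real

open MeasureTheory

lemma shift_line (f : ℂ → ℂ) (c K : ℝ) (hc : 1 ≤ c)
    (hd : ∀ s : ℂ, 0 < s.re → DifferentiableAt ℂ f s)
    (hb : ∀ s : ℂ, 1 ≤ s.re → s.re ≤ c → ‖f s‖ ≤ K * (1 + s.im ^ 2)⁻¹) :
    ∫ y : ℝ, f ((1:ℝ) + y * I) = ∫ y : ℝ, f (c + y * I) := by
  have hint : ∀ a : ℝ, 1 ≤ a → a ≤ c → Integrable (fun y : ℝ => f (a + y * I)) := by
    intro a h1 h2
    refine Integrable.mono' (integrable_inv_one_add_sq.const_mul K) ?_ ?_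
    · apply Continuous.aestronglyMeasurable
      rw [continuous_iff_continuousAt]
      intro y
      have h := (hd (a + y * I) (by simp; linarith)).continuousAt
      exact ContinuousAt.comp (f := fun y : ℝ => (a + y * I : ℂ)) h (by fun_prop)
    · refine .of_forall fun y => ?_
      have := hb (a + y * I) (by simpa using h1) (by simpa using h2)
      simpa using this
  have hrect : ∀ T : ℝ, (((∫ (x : ℝ) in (1:ℝ)..c, f (↑x + ↑(-T) * I)) - ∫ (x : ℝ) in (1:ℝ)..c, f (↑x + ↑T * I)) +
          I • ∫ (y : ℝ) in (-T)..T, f (c + ↑y * I)) -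
        I • ∫ (y : ℝ) in (-T)..T, f ((1:ℝ) + ↑y * I) = 0 := by
    intro T
    have := Complex.integral_boundary_rect_eq_zero_of_differentiableOn f (⟨1, -T⟩) ⟨c, T⟩ ?_
    · simpa using this
    · intro s hs
      apply DifferentiableAt.differentiableWithinAt
      apply hd
      have := hs.1
      simp only [Set.mem_preimage, Set.uIcc_of_le hc, Set.mem_Icc] at this
      linarith
  have hz : Filter.Tendsto (fun T : ℝ => K * (1 + T ^ 2)⁻¹ * |c - 1|) Filter.atTop (nhds 0) := by
    have h1 : Filter.Tendsto (fun T : ℝ => 1 + T ^ 2) Filter.atTop Filter.atTop :=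
      Filter.tendsto_atTop_add_const_left _ _ (Filter.tendsto_pow_atTop two_ne_zero)
    simpa using (h1.inv_tendsto_atTop.const_mul K).mul_const |c - 1|
  have hhor : ∀ e : ℝ, e ^ 2 = 1 → Filter.Tendsto (fun T : ℝ => ∫ (x : ℝ) in (1:ℝ)..c, f (↑x + ↑(e * T) * I)) Filter.atTop (nhds 0) := by
    intro e he
    refine squeeze_zero_norm (fun T => ?_) hz
    apply intervalIntegral.norm_integral_le_of_norm_le_const
    intro x hx
    rw [Set.uIoc_of_le hc] at hx
    have := hb (x + ↑(e * T) * I) (by simpa using hx.1.le) (by simpa using hx.2)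
    simpa [mul_pow, he] using this
  have h1 := hhor (-1) (by norm_num)
  have h2 := hhor 1 (by norm_num)
  simp only [neg_mul, one_mul] at h1 h2
  have h3 := intervalIntegral_tendsto_integral (hint c hc le_rfl) Filter.tendsto_neg_atTop_atBot Filter.tendsto_id
  have h4 := intervalIntegral_tendsto_integral (hint 1 le_rfl hc) Filter.tendsto_neg_atTop_atBot Filter.tendsto_id
  have h5 := ((h1.sub h2).add (h3.const_smul I)).sub (h4.const_smul I)
  have h6 := tendsto_nhds_unique (h5.congr (f₂ := fun _ => 0) (fun T => hrect T)) tendsto_const_nhds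
  simp only [sub_zero, zero_add, smul_eq_mul] at h6
  exact (mul_left_cancel₀ I_ne_zero (sub_eq_zero.1 h6)).symm

lemma norm_bd (a c : ℝ) (ha : 2 ≤ a) (hc : 1 ≤ c) (y : ℝ) :
   ‖((c:ℂ) + y * I) ^ (-a : ℂ)‖ ≤ c ^ (-(a-2)) * (1 + y^2)⁻¹ := by
  have h1 : ‖(c:ℂ) + y * I‖ ^ 2 = c ^ 2 + y ^ 2 := by
    rw [← Complex.normSq_eq_norm_sq, Complex.normSq_add_mul_I]
  have h2 : c ≤ ‖(c:ℂ) + y * I‖ := by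
    have := Complex.re_le_norm ((c:ℂ) + y * I)
    simpa using this
  have h0 : 0 < ‖(c:ℂ) + y * I‖ := by linarith
  rw [show (-a : ℂ) = ((-a : ℝ) : ℂ) by simp, Complex.norm_cpow_real,
    show -a = -(a-2) + -(2:ℕ) by push_cast; ring, Real.rpow_add h0]
  have h3 : ‖(c:ℂ) + y * I‖ ^ (-((2:ℕ):ℝ)) ≤ (1 + y^2)⁻¹ := by
    rw [Real.rpow_neg h0.le, Real.rpow_natCast, h1]
    gcongr
    nlinarith
  have h4 := Real.rpow_le_rpow_of_nonpos (by linarith) h2 (show -(a-2) ≤ 0 by linarith)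
  gcongr

lemma integrable_dens (a c : ℝ) (ha : 2 ≤ a) (hc : 0 < c) :
    IntegrableOn (fun t : ℝ => t ^ (a-1) * Real.exp (-c * t)) (Set.Ioi 0) := by
  have := integrableOn_rpow_mul_exp_neg_mul_rpow (p := 1) (s := a - 1) (b := c) (by linarith) one_pos hc
  simpa using this

lemma gamma_laplace (a : ℝ) (ha : 2 ≤ a) (r : ℂ) (hr : 0 < r.re) :
    ∫ t : ℝ in Set.Ioi 0, ((t ^ (a-1) : ℝ) : ℂ) * cexp (-r * t) = r ^ (-a : ℂ) * Complex.Gamma a := by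
  set μ : Measure ℝ := (volume.restrict (Set.Ioi 0)).withDensity
    (fun t => (Real.toNNReal (t ^ (a-1)) : ENNReal)) with hμ
  have hmeas : Measurable (fun t : ℝ => Real.toNNReal (t ^ (a-1))) := by fun_prop
  have hM : ∀ z, ProbabilityTheory.complexMGF id μ z =
      ∫ t : ℝ in Set.Ioi 0, ((t ^ (a-1) : ℝ) : ℂ) * cexp (z * t) := by
    intro z
    rw [ProbabilityTheory.complexMGF, hμ, integral_withDensity_eq_integral_smul hmeas]
    refine setIntegral_congr_fun measurableSet_Ioi fun t ht => ?_
    have : 0 ≤ t ^ (a-1) := Real.rpow_nonneg (le_of_lt ht) _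
    simp [NNReal.smul_def, Real.coe_toNNReal _ this]
  have hset : Set.Iio 0 ⊆ ProbabilityTheory.integrableExpSet id μ := by
    intro c hc
    simp only [ProbabilityTheory.integrableExpSet, Set.mem_ofPred_eq, hμ]
    rw [integrable_withDensity_iff_integrable_smul hmeas]
    refine (integrable_dens a (-c) ha (by simpa using hc)).congr_fun (fun t ht => ?_) measurableSet_Ioi
    have : 0 ≤ t ^ (a-1) := Real.rpow_nonneg (le_of_lt ht) _
    simp [NNReal.smul_def, Real.coe_toNNReal _ this]
  have hset' : Set.Iio 0 ⊆ interior (ProbabilityTheory.integrableExpSet id μ) :=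
    interior_maximal hset isOpen_Iio
  have hA : AnalyticOnNhd ℂ (ProbabilityTheory.complexMGF id μ) {z | z.re < 0} := fun z hz =>
    ProbabilityTheory.analyticAt_complexMGF (hset' hz)
  have hopen : IsOpen {z : ℂ | z.re < 0} := isOpen_lt Complex.continuous_re continuous_const
  have hB : AnalyticOnNhd ℂ (fun z : ℂ => (-z) ^ (-a : ℂ) * Complex.Gamma a) {z | z.re < 0} := by
    apply DifferentiableOn.analyticOnNhd _ hopen
    intro z hz
    apply DifferentiableAt.differentiableWithinAt
    refine DifferentiableAt.mul_const ?_ _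
    exact (differentiableAt_id.neg).cpow_const (Or.inl (by simpa using hz))
  have key := AnalyticOnNhd.eqOn_of_preconnected_of_frequently_eq hA hB
    ((convex_Iio (0:ℝ)).linear_preimage reLm).isPreconnected
    (z₀ := ((-1 : ℝ) : ℂ)) (by simp) ?_
  · have := key (show -r ∈ {z : ℂ | z.re < 0} by simpa using hr)
    rw [hM] at this
    simpa using this
  · have h_real : ∃ᶠ (x : ℝ) in nhdsWithin (-1) {-1}ᶜ, ProbabilityTheory.complexMGF id μ x =
        (-(x:ℂ)) ^ (-a : ℂ) * Complex.Gamma a := by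
      apply Filter.Eventually.frequently
      have : ∀ᶠ (x : ℝ) in nhdsWithin (-1) {-1}ᶜ, x < 0 :=
        nhdsWithin_le_nhds (Iio_mem_nhds (by norm_num))
      filter_upwards [this] with x hx
      rw [hM]
      have h := Complex.integral_cpow_mul_exp_neg_mul_Ioi (a := a) (r := -x)
        (by simp; linarith) (by linarith)
      rw [one_div, Complex.inv_cpow, ← Complex.cpow_neg] at h
      · push_cast at h
        rw [← h]
        refine setIntegral_congr_fun measurableSet_Ioi fun t ht => ?_
        rw [Complex.ofReal_cpow (le_of_lt ht)]
        simp
      · rw [Complex.arg_ofReal_of_nonneg (by linarith)]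
        exact Real.pi_pos.ne
    rw [Filter.frequently_iff_seq_forall] at h_real ⊢
    obtain ⟨xs, hx_tendsto, hx_eq⟩ := h_real
    refine ⟨fun n ↦ xs n, ?_, fun n ↦ hx_eq n⟩
    rw [tendsto_nhdsWithin_iff] at hx_tendsto ⊢
    constructor
    · rw [Filter.tendsto_ofReal_iff]
      exact hx_tendsto.1
    · simpa [Complex.ext_iff] using hx_tendsto.2

lemma cont_line (g : ℂ → ℂ) (c : ℝ) (hc : 0 < c) (hd : ∀ s : ℂ, 0 < s.re → ContinuousAt g s) :
    Continuous (fun y : ℝ => g (c + y * I)) := by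
  rw [continuous_iff_continuousAt]
  intro y
  have h := hd (c + y * I) (by simpa using hc)
  exact ContinuousAt.comp (f := fun y : ℝ => (c + y * I : ℂ)) h (by fun_prop)

lemma cont_pow (a c : ℝ) (hc : 0 < c) :
    Continuous (fun y : ℝ => ((c:ℂ) + y * I) ^ (-a : ℂ)) :=
  cont_line (fun s => s ^ (-a : ℂ)) c hc fun s hs => by
    exact (differentiableAt_id.cpow_const (Or.inl hs)).continuousAt

lemma integrable_pow (a c : ℝ) (ha : 2 ≤ a) (hc : 1 ≤ c) :
    Integrable (fun y : ℝ => ((c:ℂ) + y * I) ^ (-a : ℂ)) :=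
  Integrable.mono' (integrable_inv_one_add_sq.const_mul _)
    (cont_pow a c (by linarith)).aestronglyMeasurable (.of_forall fun y => norm_bd a c ha hc y)

lemma inv_gamma (a c : ℝ) (ha : 2 ≤ a) (hc : 1 ≤ c) :
    ∫ y : ℝ, cexp (c + y * I) * (c + y * I) ^ (-a : ℂ) = 2 * π / Complex.Gamma a := by
  have hΓ : Complex.Gamma a ≠ 0 := Complex.Gamma_ne_zero_of_re_pos (by simp; linarith)
  set h : ℝ → ℂ := (Set.Ioi 0).indicator
    (fun t : ℝ => ((t ^ (a-1) * Real.exp (-c * t) : ℝ) : ℂ)) with hh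
  have hi : Integrable h := by
    rw [hh, integrable_indicator_iff measurableSet_Ioi]
    exact (integrable_dens a c ha (by linarith)).ofReal
  have hF : FourierTransform.fourier h = fun w : ℝ => ((c:ℂ) + ((2 * π * w : ℝ) : ℂ) * I) ^ (-a : ℂ) * Complex.Gamma a := by
    funext w
    rw [Real.fourier_real_eq_integral_exp_smul, ← gamma_laplace a ha _ (by simp; linarith),
      ← integral_indicator measurableSet_Ioi]
    congr 1
    funext t
    by_cases ht : t ∈ Set.Ioi (0:ℝ)
    · simp only [hh, Set.indicator_of_mem ht, smul_eq_mul]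
      push_cast
      rw [mul_left_comm, ← Complex.exp_add]
      congr 2
      ring
    · simp [hh, Set.indicator_of_notMem ht]
  have hiF : Integrable (FourierTransform.fourier h) := by
    rw [hF]
    have h2 := (integrable_pow a c ha hc).comp_mul_left' (R := 2 * π) (by positivity)
    exact h2.mul_const _
  have hca : ContinuousAt h 1 := by
    have : (fun t : ℝ => ((t ^ (a-1) * Real.exp (-c * t) : ℝ) : ℂ)) =ᶠ[nhds 1] h := by
      filter_upwards [Ioi_mem_nhds (show (0:ℝ) < 1 by norm_num)] with t ht
      simp only [hh, Set.indicator_of_mem ht]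
    refine ContinuousAt.congr ?_ this
    apply Complex.continuous_ofReal.continuousAt.comp
    apply ContinuousAt.mul
    · exact Real.continuousAt_rpow_const _ _ (Or.inl one_ne_zero)
    · fun_prop
  have hinv := hi.fourierInv_fourier_eq hiF hca
  rw [Real.fourierInv_eq', hF] at hinv
  have h1 : h 1 = cexp (-c) := by
    simp [hh]
  rw [h1] at hinv
  have hcv := MeasureTheory.Measure.integral_comp_mul_left
    (fun y : ℝ => cexp (c + y * I) * (c + y * I) ^ (-a : ℂ)) (2 * π)
  have h3 : ∫ w : ℝ, cexp (c + (2 * π * w : ℝ) * I) * (c + (2 * π * w : ℝ) * I) ^ (-a : ℂ)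
      = 1 / Complex.Gamma a := by
    rw [eq_div_iff hΓ, ← integral_mul_const]
    rw [show (1:ℂ) = cexp c * cexp (-c) by rw [← Complex.exp_add]; simp, ← hinv,
      ← integral_const_mul]
    congr 1
    funext w
    rw [Complex.exp_add]
    simp only [smul_eq_mul]
    simp
    ring
  rw [h3] at hcv
  rw [abs_of_pos (by positivity), Complex.real_smul] at hcv
  push_cast at hcv
  have hpi : (π:ℂ) ≠ 0 := by exact_mod_cast Real.pi_ne_zero
  rw [div_eq_mul_one_div, hcv, ← mul_assoc, mul_inv_cancel₀ (by simp [hpi]), one_mul]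

lemma re_cpow (α : ℝ) (hα0 : 0 < α) (hα1 : α < 1) (s : ℂ) (hs : 0 < s.re) :
    Real.cos (α * (π / 2)) * ‖s‖ ^ α ≤ (s ^ (α : ℂ)).re := by
  have h0 : s ≠ 0 := by rintro rfl; simp at hs
  have h1 : (s ^ (α : ℂ)).re = ‖s‖ ^ α * Real.cos (s.arg * α) := by
    rw [Complex.cpow_ofReal_re]
  rw [h1, mul_comm]
  gcongr
  rw [← Real.cos_abs (s.arg * α), abs_mul, abs_of_pos hα0, mul_comm |_|]
  have := Complex.abs_arg_le_pi_div_two_iff.2 hs.le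
  have := Real.pi_pos
  apply Real.cos_le_cos_of_nonneg_of_le_pi
  · positivity
  · nlinarith
  · gcongr

/-- integrand -/
noncomputable def GG (α x : ℝ) (s : ℂ) : ℂ :=
  s ^ (-2 : ℂ) * (s ^ (α:ℂ) / (s ^ (α:ℂ) + I * x)) * (1 - α * (I * x / (s ^ (α:ℂ) + I * x)))

lemma GG_bound (α : ℝ) (hα0 : 0 < α) (hα1 : α < 1) : ∃ K : ℝ, 0 < K ∧ ∀ x : ℝ, 0 < x → ∀ s : ℂ,
    0 < s.re → DifferentiableAt ℂ (GG α x) s ∧ ‖GG α x s‖ ≤ K * ‖s‖ ^ (-2:ℝ)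
      ∧ ‖GG α x s‖ ≤ K / x * ‖s‖ ^ (α-2) := by
  set κ := Real.cos (α * (π / 2)) with hκ
  have hκ0 : 0 < κ := by
    apply Real.cos_pos_of_mem_Ioo
    have := Real.pi_pos
    constructor <;> nlinarith
  have hκ1 : κ ≤ 1 := Real.cos_le_one _
  refine ⟨(1 + 1/κ) * (1 + α * (1 + 1/κ)), by positivity, fun x hx s hs => ?_⟩
  have h0 : s ≠ 0 := by rintro rfl; simp at hs
  have hs0 : 0 < ‖s‖ := norm_pos_iff.2 h0
  have hsl : s ∈ slitPlane := Or.inl hs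
  have hq := re_cpow α hα0 hα1 s hs
  have hqn : ‖s ^ (α:ℂ)‖ = ‖s‖ ^ α := Complex.norm_cpow_real _ _
  have hm : 0 < ‖s‖ ^ α := by positivity
  have hD1 : κ * ‖s‖ ^ α ≤ ‖s ^ (α:ℂ) + I * x‖ := by
    refine hq.trans ?_
    have := Complex.re_le_norm (s ^ (α:ℂ) + I * x)
    simpa using this
  have hDpos : 0 < ‖s ^ (α:ℂ) + I * x‖ := lt_of_lt_of_le (by positivity) hD1
  have hDne := norm_pos_iff.1 hDpos
  have hD2 : x ≤ (1 + 1/κ) * ‖s ^ (α:ℂ) + I * x‖ := by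
    have h1 : ‖I * (x:ℂ)‖ ≤ ‖s ^ (α:ℂ) + I * x‖ + ‖s ^ (α:ℂ)‖ := by
      have := norm_sub_le (s ^ (α:ℂ) + I * x) (s ^ (α:ℂ))
      simpa using this
    rw [norm_mul, norm_I, one_mul, Complex.norm_real, Real.norm_of_nonneg hx.le, hqn] at h1
    have h2 : ‖s‖ ^ α ≤ 1/κ * ‖s ^ (α:ℂ) + I * x‖ := by
      rw [one_div, ← div_eq_inv_mul, le_div_iff₀ hκ0]; linarith
    linarith
  have e2 : ‖s ^ (-2 : ℂ)‖ = ‖s‖ ^ (-2:ℝ) := by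
    rw [show (-2 : ℂ) = ((-2 : ℝ) : ℂ) by simp, Complex.norm_cpow_real]
  have b3 : ‖1 - α * (I * x / (s ^ (α:ℂ) + I * x))‖ ≤ 1 + α * (1 + 1/κ) := by
    refine (norm_sub_le _ _).trans ?_
    rw [norm_one, norm_mul, Complex.norm_real, Real.norm_of_nonneg hα0.le, norm_div, norm_mul, norm_I,
      one_mul, Complex.norm_real, Real.norm_of_nonneg hx.le]
    gcongr
    rwa [div_le_iff₀ hDpos]
  have b2 : ‖s ^ (α:ℂ) / (s ^ (α:ℂ) + I * x)‖ ≤ 1 + 1/κ := by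
    rw [norm_div, div_le_iff₀ hDpos, hqn]
    have h2 : ‖s‖ ^ α ≤ 1/κ * ‖s ^ (α:ℂ) + I * x‖ := by
      rw [one_div, ← div_eq_inv_mul, le_div_iff₀ hκ0]; linarith
    linarith
  have b2' : ‖s ^ (α:ℂ) / (s ^ (α:ℂ) + I * x)‖ ≤ (1 + 1/κ) / x * ‖s‖ ^ α := by
    rw [norm_div, div_le_iff₀ hDpos, hqn]
    have : ‖s‖ ^ α * x ≤ ‖s‖ ^ α * ((1 + 1/κ) * ‖s ^ (α:ℂ) + I * x‖) := by gcongr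
    rw [show (1 + 1/κ) / x * ‖s‖ ^ α * ‖s ^ (α:ℂ) + I * x‖ = ‖s‖ ^ α * ((1 + 1/κ) * ‖s ^ (α:ℂ) + I * x‖) / x by ring,
      le_div_iff₀ hx]
    exact this
  refine ⟨?_, ?_, ?_⟩
  · unfold GG
    have d1 : DifferentiableAt ℂ (fun s : ℂ => s ^ (α:ℂ)) s :=
      differentiableAt_id.cpow_const hsl
    have d2 : DifferentiableAt ℂ (fun s : ℂ => s ^ (-2:ℂ)) s :=
      differentiableAt_id.cpow_const hsl
    have d3 : DifferentiableAt ℂ (fun s : ℂ => s ^ (α:ℂ) + I * x) s := d1.add_const _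
    exact (d2.mul (d1.div d3 hDne)).mul
      (((((differentiableAt_const _).div d3 hDne)).const_mul _).const_sub _)
  · unfold GG
    rw [norm_mul, norm_mul, e2]
    calc _ ≤ ‖s‖ ^ (-2:ℝ) * (1 + 1/κ) * (1 + α * (1 + 1/κ)) := by gcongr
      _ = _ := by ring
  · unfold GG
    rw [norm_mul, norm_mul, e2]
    calc _ ≤ ‖s‖ ^ (-2:ℝ) * ((1 + 1/κ) / x * ‖s‖ ^ α) * (1 + α * (1 + 1/κ)) := by gcongr
      _ = _ := by
        rw [sub_eq_add_neg α, Real.rpow_add hs0]; ring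

lemma GG_series (α x : ℝ) (hα0 : 0 < α) (s : ℂ) (hs : 0 < s.re) (hx : 0 < x) (hlt : x < ‖s‖ ^ α) :
    HasSum (fun n : ℕ => (α * n + 1 : ℂ) * (-I * x) ^ n * s ^ (-((α * n + 2 : ℝ):ℂ))) (GG α x s) := by
  have h0 : s ≠ 0 := by rintro rfl; simp at hs
  have hs0 : 0 < ‖s‖ := norm_pos_iff.2 h0
  have hq0 : s ^ (α:ℂ) ≠ 0 := by simp [Complex.cpow_eq_zero_iff, h0]
  set q := s ^ (α:ℂ) with hq
  have hqn : ‖q‖ = ‖s‖ ^ α := Complex.norm_cpow_real _ _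
  set w : ℂ := -I * x / q with hw
  have hwn : ‖w‖ < 1 := by
    rw [hw, norm_div, hqn, norm_mul, norm_neg, norm_I, one_mul, Complex.norm_real,
      Real.norm_of_nonneg hx.le, div_lt_one (by positivity)]
    exact hlt
  have h1 := (((hasSum_coe_mul_geometric_of_norm_lt_one hwn).mul_left (α:ℂ)).add
    (hasSum_geometric_of_norm_lt_one hwn)).mul_left (s ^ (-2:ℂ))
  have hw1 : 1 - w ≠ 0 := by
    intro h
    rw [← sub_eq_zero.1 h] at hwn; simp at hwn
  have hqx : q + I * x ≠ 0 := by
    have : q + I * x = q * (1 - w) := by rw [hw]; field_simp; ring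
    rw [this]; exact mul_ne_zero hq0 hw1
  have ea : ∀ n : ℕ, (α * n + 1 : ℂ) * (-I * x) ^ n * s ^ (-((α * n + 2 : ℝ):ℂ)) =
      s ^ (-2:ℂ) * (α * (n * w ^ n) + w ^ n) := by
    intro n
    have : s ^ (-((α * n + 2 : ℝ):ℂ)) = s ^ (-2:ℂ) * (q ^ n)⁻¹ := by
      rw [hq, ← Complex.cpow_nat_mul, ← Complex.cpow_neg, ← Complex.cpow_add _ _ h0]
      congr 1; push_cast; ring
    rw [this, hw, div_pow]
    ring
  have eb : GG α x s = s ^ (-2:ℂ) * (α * (w / (1 - w) ^ 2) + (1 - w)⁻¹) := by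
    have e1 : 1 - w = (q + I * x) / q := by rw [hw]; field_simp; ring
    rw [e1, GG, ← hq, hw]
    field_simp
    ring
  rw [funext ea, eb]
  exact h1

lemma mlE_eq (α x : ℝ) (hα0 : 0 < α) (hα1 : α < 1) (hx : 0 < x) :
    2 * π * mlE α 1 (-I * x) = ∫ y : ℝ, cexp ((1:ℝ) + y * I) * GG α x ((1:ℝ) + y * I) := by
  obtain ⟨K, hK, hG⟩ := GG_bound α hα0 hα1
  obtain ⟨c, hc1, hcx⟩ : ∃ c : ℝ, 1 ≤ c ∧ x < c ^ α :=
    ((Filter.eventually_ge_atTop 1).and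
      ((tendsto_rpow_atTop hα0).eventually_gt_atTop x)).exists
  have hc0 : 0 < c := by linarith
  have hsh := shift_line (fun s => cexp s * GG α x s) c (Real.exp c * K) hc1
    (fun s hs => Complex.differentiableAt_exp.mul (hG x hx s hs).1) (by
      intro s h1 h2
      have hb := (hG x hx s (by linarith)).2.1
      rw [norm_mul, Complex.norm_exp, mul_assoc]
      have h3 : ‖s‖ ^ (-2:ℝ) ≤ (1 + s.im ^ 2)⁻¹ := by
        rw [show (-2:ℝ) = -((2:ℕ):ℝ) by norm_num, Real.rpow_neg (norm_nonneg _), Real.rpow_natCast,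
          ← Complex.normSq_eq_norm_sq, Complex.normSq_apply]
        refine inv_anti₀ (by positivity) ?_
        nlinarith
      have : ‖GG α x s‖ ≤ K * (1 + s.im ^ 2)⁻¹ := hb.trans (by gcongr)
      gcongr)
  rw [hsh]
  set F : ℕ → ℝ → ℂ := fun n y => cexp (c + y * I) *
    ((α * n + 1 : ℂ) * (-I * x) ^ n * (c + y * I) ^ (-((α * n + 2 : ℝ):ℂ))) with hF
  have ha : ∀ n : ℕ, 2 ≤ α * n + 2 := fun n => by have : 0 ≤ α * n := by positivity
                                                  linarith
  have hFn : ∀ n y, ‖F n y‖ ≤ Real.exp c * ((α * n + 1) * (x / c ^ α) ^ n) * (1 + y^2)⁻¹ := by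
    intro n y
    have h1 := norm_bd (α * n + 2) c (ha n) hc1 y
    have e1 : ‖(α * n + 1 : ℂ)‖ = α * n + 1 := by
      rw [show (α * n + 1 : ℂ) = ((α * n + 1 : ℝ) : ℂ) by push_cast; ring, Complex.norm_real,
        Real.norm_of_nonneg (by positivity)]
    have e2 : c ^ (-(α * n + 2 - 2)) = ((c ^ α) ^ n)⁻¹ := by
      rw [Real.rpow_neg hc0.le, add_sub_cancel_right, Real.rpow_mul hc0.le, Real.rpow_natCast]
    simp only [hF]
    rw [norm_mul, norm_mul, norm_mul, Complex.norm_exp, e1, norm_pow, norm_mul, norm_neg, norm_I, one_mul,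
      Complex.norm_real, Real.norm_of_nonneg hx.le]
    rw [e2] at h1
    calc _ ≤ Real.exp c * ((α * n + 1) * x ^ n * (((c ^ α) ^ n)⁻¹ * (1 + y^2)⁻¹)) := by
          simp only [add_re, ofReal_re, mul_re, I_re, mul_zero, ofReal_im, I_im, mul_one, sub_self, add_zero]
          gcongr
      _ = _ := by rw [div_pow]; ring
  have hFi : ∀ n, Integrable (F n) := by
    intro n
    refine Integrable.mono' (integrable_inv_one_add_sq.const_mul _) ?_ (.of_forall (hFn n))
    apply Continuous.aestronglyMeasurable
    have := cont_pow (α * n + 2) c hc0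
    simp only [hF]
    fun_prop
  have hqpos : 0 ≤ x / c ^ α := by positivity
  have hq1 : x / c ^ α < 1 := (div_lt_one (by positivity)).2 hcx
  have hq1' : ‖x / c ^ α‖ < 1 := by rwa [Real.norm_of_nonneg hqpos]
  have hsum0 : Summable (fun n : ℕ => (α * n + 1) * (x / c ^ α) ^ n) := by
    have := ((hasSum_coe_mul_geometric_of_norm_lt_one hq1').summable.mul_left α).add
      (hasSum_geometric_of_norm_lt_one hq1').summable
    refine this.congr fun n => ?_
    ring
  have hsum : Summable (fun n => ∫ y, ‖F n y‖) := by
    refine Summable.of_nonneg_of_le (fun n => integral_nonneg fun y => norm_nonneg _) (fun n => ?_)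
      ((hsum0.mul_left (Real.exp c)).mul_right (∫ y : ℝ, (1 + y^2)⁻¹))
    rw [← integral_const_mul]
    exact integral_mono (hFi n).norm (integrable_inv_one_add_sq.const_mul _) (hFn n)
  have hS := hasSum_integral_of_summable_integral_norm hFi hsum
  have e1 : ∫ y, ∑' n, F n y = ∫ y : ℝ, cexp (c + y * I) * GG α x (c + y * I) := by
    congr 1; funext y
    apply HasSum.tsum_eq
    apply HasSum.mul_left
    apply GG_series α x hα0 _ (by simpa using hc0) hx
    refine hcx.trans_le ?_
    have := Complex.re_le_norm ((c:ℂ) + y * I)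
    simp only [add_re, ofReal_re, mul_re, I_re, mul_zero, ofReal_im, I_im, mul_one, sub_self, add_zero] at this
    gcongr
  rw [← e1, ← hS.tsum_eq, mlE, ← tsum_mul_left]
  congr 1; funext n
  have e3 : F n = fun y : ℝ => ((α * n + 1 : ℂ) * (-I * x) ^ n) *
      (cexp (c + y * I) * (c + y * I) ^ (-((α * n + 2 : ℝ):ℂ))) := by
    funext y; simp only [hF]; ring
  have hne : ((α * n + 1 : ℝ) : ℂ) ≠ 0 := by
    have : 0 < α * n + 1 := by positivity
    exact_mod_cast this.ne'
  have e4 := Complex.Gamma_add_one _ hne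
  have hΓ : Complex.Gamma ((α * n + 1 : ℝ) : ℂ) ≠ 0 :=
    Complex.Gamma_ne_zero_of_re_pos (by rw [ofReal_re]; positivity)
  rw [e3, integral_const_mul, inv_gamma (α * n + 2) c (ha n) hc1,
    show ((α * n + 2 : ℝ) : ℂ) = ((α * n + 1 : ℝ) : ℂ) + 1 by push_cast; ring, e4,
    show (α * n + 1 : ℂ) = ((α * n + 1 : ℝ) : ℂ) by push_cast; ring]
  field_simp

lemma mlE_bound (α : ℝ) (hα0 : 0 < α) (hα1 : α < 1) : ∃ C : ℝ, 0 < C ∧ ∀ x : ℝ, 0 < x →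
    √x * ‖mlE α 1 (-I * x)‖ ≤ C := by
  obtain ⟨K, hK, hG⟩ := GG_bound α hα0 hα1
  have hJ : Integrable (fun y : ℝ => (1 + y ^ 2) ^ (-(2 - α) / 2)) := by
    have := integrable_rpow_neg_one_add_norm_sq (E := ℝ) (μ := volume) (r := 2 - α) (by simp; linarith)
    simpa using this
  set J := ∫ y : ℝ, (1 + y ^ 2) ^ (-(2 - α) / 2) with hJdef
  have hJ0 : 0 ≤ J := integral_nonneg fun y => by positivity
  have main : ∀ x : ℝ, 0 < x → ∀ B : ℝ, 0 ≤ B → (∀ s : ℂ, 1 ≤ s.re → ‖GG α x s‖ ≤ B * ‖s‖ ^ (α - 2)) →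
      ‖mlE α 1 (-I * x)‖ ≤ Real.exp 1 * B * J := by
    intro x hx B hB hb
    have h1 : ‖∫ y : ℝ, cexp ((1:ℝ) + y * I) * GG α x ((1:ℝ) + y * I)‖ ≤ Real.exp 1 * B * J := by
      rw [hJdef, ← integral_const_mul]
      refine norm_integral_le_of_norm_le (hJ.const_mul _) (.of_forall fun y => ?_)
      have h2 := hb ((1:ℝ) + y * I) (by simp)
      have e : ‖((1:ℝ):ℂ) + y * I‖ ^ (α - 2) = (1 + y ^ 2) ^ (-(2 - α) / 2) := by
        rw [Complex.norm_add_mul_I, Real.sqrt_eq_rpow, ← Real.rpow_mul (by positivity)]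
        congr 1
        · ring
        · ring
      rw [e] at h2
      rw [norm_mul, Complex.norm_exp, mul_assoc]
      simp only [add_re, ofReal_re, mul_re, I_re, mul_zero, ofReal_im, I_im, mul_one, sub_self, add_zero]
      gcongr
    rw [← mlE_eq α x hα0 hα1 hx, norm_mul] at h1
    have h3 : (1:ℝ) ≤ ‖(2 * π : ℂ)‖ := by
      rw [show (2 * π : ℂ) = ((2 * π : ℝ):ℂ) by push_cast; ring, Complex.norm_real,
        Real.norm_of_nonneg (by positivity)]
      have := Real.pi_gt_three
      linarith
    have := norm_nonneg (mlE α 1 (-I * x))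
    nlinarith
  refine ⟨Real.exp 1 * K * J + 1, by positivity, fun x hx => ?_⟩
  suffices √x * ‖mlE α 1 (-I * x)‖ ≤ Real.exp 1 * K * J by linarith
  rcases le_total x 1 with h | h
  · have h1 := main x hx K hK.le (fun s hs => by
      refine (hG x hx s (by linarith)).2.1.trans ?_
      have : 1 ≤ ‖s‖ := hs.trans (Complex.re_le_norm s)
      gcongr
      linarith)
    have : √x ≤ 1 := Real.sqrt_le_one.2 h
    have := norm_nonneg (mlE α 1 (-I * x))
    have := Real.sqrt_nonneg x
    nlinarith
  · have h1 := main x hx (K / x) (by positivity) (fun s hs => (hG x hx s (by linarith)).2.2)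
    have h2 : √x ≤ x := by
      rw [Real.sqrt_le_left (by linarith)]; nlinarith
    calc _ ≤ x * (Real.exp 1 * (K / x) * J) := by gcongr
      _ = _ := by field_simp

theorem smoothing_estimate (α : ℝ) (hα0 : 0 < α) (hα1 : α < 1)
    (H : Type*) [NormedAddCommGroup H] [InnerProductSpace ℂ H] [CompleteSpace H]
    (b : HilbertBasis ℕ ℂ H) (lam : ℕ → ℝ) (hlam : ∀ n, 0 < lam n) (u₀ : H) :
    ∃ C : ℝ, 0 < C ∧
      (∀ l t : ℝ, 0 < l → 0 < t →
        l ^ ((1 : ℝ) / 2) * ‖mlE α 1 (-Complex.I * l * (t ^ α : ℝ))‖ ≤ C * t ^ (-α / 2)) ∧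
      (∀ t : ℝ, 0 < t →
        (∑' n : ℕ, lam n * ‖b.repr u₀ n * mlE α 1 (-Complex.I * lam n * (t ^ α : ℝ))‖ ^ 2)
          ≤ C ^ 2 * t ^ (-α) * ‖u₀‖ ^ 2) := by
  obtain ⟨C, hC, hb⟩ := mlE_bound α hα0 hα1
  have h1 : ∀ l t : ℝ, 0 < l → 0 < t →
        l ^ ((1 : ℝ) / 2) * ‖mlE α 1 (-Complex.I * l * (t ^ α : ℝ))‖ ≤ C * t ^ (-α / 2) := by
    intro l t hl ht
    have h := hb (l * t ^ α) (by positivity)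
    have e : (-I * ((l * t ^ α : ℝ) : ℂ)) = -I * l * (t ^ α : ℝ) := by push_cast; ring
    rw [e, Real.sqrt_eq_rpow, Real.mul_rpow hl.le (by positivity), ← Real.rpow_mul ht.le] at h
    rw [neg_div, Real.rpow_neg ht.le, ← div_eq_mul_inv, le_div_iff₀ (by positivity)]
    calc _ = _ := by ring_nf
      _ ≤ C := h
  refine ⟨C, hC, h1, fun t ht => ?_⟩
  have hs : HasSum (fun n => ‖b.repr u₀ n‖ ^ 2) (‖u₀‖ ^ 2) := by
    have := lp.hasSum_norm (p := 2) (by norm_num) (b.repr u₀)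
    simpa using this
  have hle : ∀ n, lam n * ‖b.repr u₀ n * mlE α 1 (-Complex.I * lam n * (t ^ α : ℝ))‖ ^ 2
      ≤ C ^ 2 * t ^ (-α) * ‖b.repr u₀ n‖ ^ 2 := by
    intro n
    have h2 := pow_le_pow_left₀ (by have := hlam n; positivity) (h1 (lam n) t (hlam n) ht) 2
    rw [mul_pow, mul_pow, ← Real.rpow_mul_natCast (hlam n).le, ← Real.rpow_mul_natCast ht.le] at h2
    rw [show (1:ℝ)/2 * (2:ℕ) = 1 by norm_num, Real.rpow_one,
      show -α/2 * (2:ℕ) = -α by push_cast; ring] at h2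
    rw [norm_mul, mul_pow]
    have := mul_le_mul_of_nonneg_left h2 (sq_nonneg ‖b.repr u₀ n‖)
    calc _ = _ := by ring
      _ ≤ _ := this
      _ = _ := by ring
  have hs2 := hs.mul_left (C ^ 2 * t ^ (-α))
  rw [← hs2.tsum_eq]
  refine Summable.tsum_le_tsum hle ?_ hs2.summable
  exact Summable.of_nonneg_of_le (fun n => by have := hlam n; positivity) hle hs2.summable
end
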